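/- (Strict version / interior of the polytope.) Let d ≥ 1, let A be a d×d Hermitian complex matrix with eigenvalue vector μ ∈ ℝ^d (listed with multiplicity), let ρ be a d×d positive semidefinite Hermitian matrix with trace 1 and eigenvalue vector λ ∈ ℝ^d, and let W ∈ ℝ. Then Re Tr(U ρ U* A) > W for every d×d unitary matrix U if and only if Σ_i λ↓_i μ↑_i > W, where λ↓ is the decreasing rearrangement of λ and μ↑ is the increasing rearrangement of μ. -/

import Mathlib

open scoped ComplexOrder

/-- The entries of `v` sorted in increasing order. -/
noncomputable def sortAsc {d : ℕ} (v : Fin d → ℝ) : Fin d → ℝ :=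
  v ∘ Tuple.sort v

/-- The entries of `v` sorted in decreasing order. -/
noncomputable def sortDesc {d : ℕ} (v : Fin d → ℝ) : Fin d → ℝ :=
  fun i => (v ∘ Tuple.sort v) i.rev

open Matrix

theorem permMatrix_map_normSq {n : Type*} [DecidableEq n] (σ : Equiv.Perm n) :
    (σ.permMatrix ℂ).map Complex.normSq = σ.permMatrix ℝ := by
  ext i j
  simp only [map_apply, Equiv.Perm.permMatrix, PEquiv.toMatrix_apply]
  split_ifs <;> simp

section Unitary

variable {n : Type*} [Fintype n] [DecidableEq n]

/-- The squared moduli of the entries of a unitary matrix form a doubly stochastic matrix. -/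
theorem normSq_mem_doublyStochastic {V : Matrix n n ℂ} (hV : V ∈ unitaryGroup n ℂ) :
    V.map Complex.normSq ∈ doublyStochastic ℝ n := by
  rw [mem_doublyStochastic_iff_sum]
  refine ⟨fun i j => Complex.normSq_nonneg _, fun i => ?_, fun j => ?_⟩
  · have h := congrFun (congrFun (mem_unitaryGroup_iff.mp hV) i) i
    simp only [mul_apply, star_apply, one_apply_eq, RCLike.star_def, Complex.mul_conj] at h
    exact_mod_cast h
  · have h := congrFun (congrFun (mem_unitaryGroup_iff'.mp hV) j) j
    simp only [mul_apply, star_apply, one_apply_eq, RCLike.star_def, mul_comm (starRingEnd ℂ _),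
      Complex.mul_conj] at h
    exact_mod_cast h

theorem re_trace_conj_diagonal_mul_diagonal (V : Matrix n n ℂ) (a r : n → ℝ) :
    (trace (V * diagonal (fun i => (r i : ℂ)) * star V * diagonal (fun i => (a i : ℂ)))).re =
      ∑ i, ∑ j, V.map Complex.normSq i j * (r j * a i) := by
  have h : trace (V * diagonal (fun i => (r i : ℂ)) * star V * diagonal (fun i => (a i : ℂ))) =
      ((∑ i, ∑ j, V.map Complex.normSq i j * (r j * a i) : ℝ) : ℂ) := by
    push_cast
    simp only [trace, diag_apply, mul_diagonal, mul_apply (N := star V), star_apply, map_apply,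
      Finset.sum_mul, RCLike.star_def, ← Complex.mul_conj]
    refine Finset.sum_congr rfl fun i _ => Finset.sum_congr rfl fun j _ => ?_
    ring
  rw [h, Complex.ofReal_re]

theorem sum_permMatrix_mul (σ : Equiv.Perm n) (f : n → n → ℝ) :
    ∑ i, ∑ j, σ.permMatrix ℝ i j * f i j = ∑ i, f i (σ i) := by
  simp [Equiv.Perm.permMatrix, PEquiv.toMatrix_apply, Equiv.toPEquiv_apply]

/-- A linear functional that is at least `c` on permutation matrices is at least `c` on doubly
stochastic matrices. -/
theorem le_sum_mul_of_mem_doublyStochastic {M : Matrix n n ℝ} (hM : M ∈ doublyStochastic ℝ n)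
    {f : n → n → ℝ} {c : ℝ} (hc : ∀ σ : Equiv.Perm n, c ≤ ∑ i, f i (σ i)) :
    c ≤ ∑ i, ∑ j, M i j * f i j := by
  obtain ⟨w, hw, hw1, rfl⟩ := exists_eq_sum_perm_of_mem_doublyStochastic hM
  calc c = ∑ σ, w σ * c := by rw [← Finset.sum_mul, hw1, one_mul]
    _ ≤ ∑ σ, w σ * ∑ i, ∑ j, σ.permMatrix ℝ i j * f i j := by
      gcongr with σ
      · exact hw σ
      · rw [sum_permMatrix_mul]
        exact hc σ
    _ = _ := by
      simp only [Matrix.sum_apply, Matrix.smul_apply, smul_eq_mul, Finset.sum_mul, Finset.mul_sum,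
        mul_assoc]
      rw [Finset.sum_comm]
      exact Finset.sum_congr rfl fun i _ => Finset.sum_comm

theorem permMatrix_mem_unitaryGroup (σ : Equiv.Perm n) : σ.permMatrix ℂ ∈ unitaryGroup n ℂ := by
  rw [mem_unitaryGroup_iff, star_eq_conjTranspose, conjTranspose_permMatrix, ← permMatrix_mul]
  simp

/-- Replacing `U` by its expression in eigenbases of `ρ` and `A`, the trace only involves the
eigenvalues. -/
theorem trace_conj_mul_eq {A ρ : Matrix n n ℂ} (hA : A.IsHermitian) (hρ : ρ.IsHermitian)
    (V : Matrix n n ℂ) :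
    trace ((hA.eigenvectorUnitary : Matrix n n ℂ) * V *
        star (hρ.eigenvectorUnitary : Matrix n n ℂ) * ρ *
        star ((hA.eigenvectorUnitary : Matrix n n ℂ) * V *
          star (hρ.eigenvectorUnitary : Matrix n n ℂ)) * A) =
      trace (V * diagonal (fun i => (hρ.eigenvalues i : ℂ)) * star V *
        diagonal (fun i => (hA.eigenvalues i : ℂ))) := by
  have eA := hA.spectral_theorem
  have eρ := hρ.spectral_theorem
  rw [Unitary.conjStarAlgAut_apply] at eA eρ
  have hP : star (hA.eigenvectorUnitary : Matrix n n ℂ) * hA.eigenvectorUnitary = 1 :=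
    Unitary.coe_star_mul_self _
  have hQ : star (hρ.eigenvectorUnitary : Matrix n n ℂ) * hρ.eigenvectorUnitary = 1 :=
    Unitary.coe_star_mul_self _
  generalize (hA.eigenvectorUnitary : Matrix n n ℂ) = P at *
  generalize (hρ.eigenvectorUnitary : Matrix n n ℂ) = Q at *
  have eA' : A = P * diagonal (fun i => (hA.eigenvalues i : ℂ)) * star P := eA
  have eρ' : ρ = Q * diagonal (fun i => (hρ.eigenvalues i : ℂ)) * star Q := eρ
  generalize diagonal (fun i => (hA.eigenvalues i : ℂ)) = D at *
  generalize diagonal (fun i => (hρ.eigenvalues i : ℂ)) = E at *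
  have key : P * V * star Q * ρ * star (P * V * star Q) * A =
      P * (V * E * star V * D) * star P := by
    calc _ = P * V * (star Q * Q) * E * (star Q * Q) * star V * (star P * P) * D * star P := by
          rw [eA', eρ']
          simp only [star_mul, star_star, mul_assoc]
      _ = _ := by
          rw [hP, hQ]
          simp only [mul_one, mul_assoc]
  rw [key, trace_mul_comm, ← mul_assoc, hP, one_mul]

end Unitary

theorem sortAsc_monotone {d : ℕ} (v : Fin d → ℝ) : Monotone (sortAsc v) :=
  Tuple.monotone_sort v

theorem sortDesc_antitone {d : ℕ} (v : Fin d → ℝ) : Antitone (sortDesc v) :=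
  fun _ _ h => Tuple.monotone_sort v (Fin.rev_le_rev.mpr h)

/-- Pairing oppositely sorted rearrangements of `r` and `a` gives the least sum of products over
all pairings, and this sum is attained. -/
theorem isLeast_sum_mul_sort {d : ℕ} (r a : Fin d → ℝ) (α β : Equiv.Perm (Fin d)) :
    IsLeast (Set.range fun σ : Equiv.Perm (Fin d) => ∑ i, r (σ i) * a i)
      (∑ i, sortDesc (r ∘ α) i * sortAsc (a ∘ β) i) := by
  set s := (Fin.revPerm.trans (Tuple.sort (r ∘ α))).trans α
  set t := (Tuple.sort (a ∘ β)).trans β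
  have er : sortDesc (r ∘ α) = r ∘ s := rfl
  have ea : sortAsc (a ∘ β) = a ∘ t := rfl
  constructor
  · refine ⟨t.symm.trans s, ?_⟩
    simp only [er, ea]
    rw [← t.sum_comp]
    simp
  · rintro _ ⟨σ, rfl⟩
    have hanti : Antivary (sortDesc (r ∘ α)) (sortAsc (a ∘ β)) :=
      (sortDesc_antitone _).antivary (sortAsc_monotone _)
    have h := hanti.sum_mul_le_sum_comp_perm_mul (σ := (t.trans σ).trans s.symm)
    refine h.trans_eq ?_
    simp only [er, ea]
    rw [← t.sum_comp fun i => r (σ i) * a i]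
    simp

/-- strict version / interior of the polytope:
`Re Tr(U ρ U* A) > W` for every unitary `U` iff `Σ_i λ↓_i μ↑_i > W`. -/
theorem stmt_5 (d : ℕ) (hd : 1 ≤ d) (A ρ : Matrix (Fin d) (Fin d) ℂ)
    (hA : A.IsHermitian) (hρ : ρ.PosSemidef) (hρtr : ρ.trace = 1)
    (μ lam : Fin d → ℝ)
    (hμ : ∃ σ : Equiv.Perm (Fin d), μ = hA.eigenvalues ∘ σ)
    (hlam : ∃ σ : Equiv.Perm (Fin d), lam = hρ.1.eigenvalues ∘ σ)
    (W : ℝ) :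
    (∀ U : Matrix (Fin d) (Fin d) ℂ, U ∈ Matrix.unitaryGroup (Fin d) ℂ →
        (Matrix.trace (U * ρ * star U * A)).re > W) ↔
      ∑ i : Fin d, sortDesc lam i * sortAsc μ i > W := by
  obtain ⟨β, rfl⟩ := hμ
  obtain ⟨α, rfl⟩ := hlam
  obtain ⟨⟨σ, hσ⟩, hle⟩ := isLeast_sum_mul_sort hρ.1.eigenvalues hA.eigenvalues α β
  have hP := hA.eigenvectorUnitary.2
  have hQ := hρ.1.eigenvectorUnitary.2
  constructor
  · intro h
    have hU := h _ (mul_mem (mul_mem hP (permMatrix_mem_unitaryGroup σ)) (Unitary.star_mem hQ))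
    rw [trace_conj_mul_eq, re_trace_conj_diagonal_mul_diagonal, permMatrix_map_normSq,
      sum_permMatrix_mul σ fun i j => hρ.1.eigenvalues j * hA.eigenvalues i] at hU
    exact hU.trans_eq hσ
  · intro h U hU
    have hV := mul_mem (mul_mem (Unitary.star_mem hP) hU) hQ
    have hUV : U = (hA.eigenvectorUnitary : Matrix (Fin d) (Fin d) ℂ) *
        (star (hA.eigenvectorUnitary : Matrix (Fin d) (Fin d) ℂ) * U *
          (hρ.1.eigenvectorUnitary : Matrix (Fin d) (Fin d) ℂ)) *
        star (hρ.1.eigenvectorUnitary : Matrix (Fin d) (Fin d) ℂ) := by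
      rw [mul_assoc, mul_assoc, mul_assoc, Unitary.mul_star_self_of_mem hQ, mul_one,
        ← mul_assoc, Unitary.mul_star_self_of_mem hP, one_mul]
    rw [hUV, trace_conj_mul_eq, re_trace_conj_diagonal_mul_diagonal]
    exact lt_of_lt_of_le h (le_sum_mul_of_mem_doublyStochastic (normSq_mem_doublyStochastic hV)
      fun τ => hle ⟨τ, rfl⟩)
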